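/- Let M be the free R-module on five generators x0, x2, y2, x4, y4, and let d : M → M be the R-linear map with d(x2) = x0 + U·y2, d(x4) = y2 + U·y4, and d(x0) = d(y2) = d(y4) = 0. Then d ∘ d = 0, and the homology H = ker d / im d is a free R-module of rank 1, generated by the class of y4. -/

import Mathlib

noncomputable section

/-- `R = 𝔽₂[U]`, the polynomial ring in one variable over the field with two elements. -/
abbrev R : Type := Polynomial (ZMod 2)

/-- The variable `U` of `R = 𝔽₂[U]`. -/
def U : R := Polynomial.X

/-- The free `R`-module on five generators. -/
abbrev M : Type := Fin 5 → R

def x0 : M := Pi.single 0 1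
def x2 : M := Pi.single 1 1
def y2 : M := Pi.single 2 1
def x4 : M := Pi.single 3 1
def y4 : M := Pi.single 4 1

/-- A vector of `M` in terms of the five generators. -/
theorem eq_sum_generators (v : M) :
    v = v 0 • x0 + v 1 • x2 + v 2 • y2 + v 3 • x4 + v 4 • y4 := by
  funext i
  fin_cases i <;> simp [x0, x2, y2, x4, y4]

theorem differential_apply (d : M →ₗ[R] M)
    (hx2 : d x2 = x0 + U • y2) (hx4 : d x4 = y2 + U • y4)
    (hx0 : d x0 = 0) (hy2 : d y2 = 0) (hy4 : d y4 = 0) (v : M) :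
    d v = v 1 • (x0 + U • y2) + v 3 • (y2 + U • y4) := by
  conv_lhs => rw [eq_sum_generators v]
  simp only [map_add, map_smul, hx0, hx2, hy2, hx4, hy4, smul_zero, zero_add, add_zero]

/-- Let `M` be the free `R`-module on the five generators `x0, x2, y2, x4, y4`, and let
`d : M → M` be the `R`-linear map with `d x2 = x0 + U • y2`, `d x4 = y2 + U • y4`, and
`d x0 = d y2 = d y4 = 0`.  Then `d ∘ d = 0`, and the homology `H = ker d / im d` is a free
`R`-module of rank one generated by the class of `y4`, i.e. the map `R → H`,
`r ↦ r • [y4]`, is bijective. -/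
theorem homology_free_rank_one (d : M →ₗ[R] M)
    (hx2 : d x2 = x0 + U • y2)
    (hx4 : d x4 = y2 + U • y4)
    (hx0 : d x0 = 0) (hy2 : d y2 = 0) (hy4 : d y4 = 0) :
    d ∘ₗ d = 0 ∧
    ∃ hz : y4 ∈ LinearMap.ker d,
      Function.Bijective
        (LinearMap.toSpanSingleton R
          (LinearMap.ker d ⧸ (LinearMap.range d).comap (LinearMap.ker d).subtype)
          (Submodule.Quotient.mk ⟨y4, hz⟩)) := by
  have hd := differential_apply d hx2 hx4 hx0 hy2 hy4
  refine ⟨?_, hy4, ?_, ?_⟩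
  · refine LinearMap.ext fun v => ?_
    simp [hd v, hx0, hy2, hy4]
  · rw [injective_iff_map_eq_zero]
    intro r hr
    rw [LinearMap.toSpanSingleton_apply, ← Submodule.Quotient.mk_smul,
      Submodule.Quotient.mk_eq_zero] at hr
    obtain ⟨v, hv⟩ := hr
    rw [hd v] at hv
    have h0 : v 1 = 0 := by simpa [x0, y2, y4] using congrFun hv 0
    have h2 : v 3 = 0 := by simpa [x0, y2, y4, h0] using congrFun hv 2
    simpa [x0, y2, y4, h0, h2] using (congrFun hv 4).symm
  · intro q
    obtain ⟨⟨z, hz⟩, rfl⟩ := Submodule.Quotient.mk_surjective _ q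
    have hz' := hz
    rw [LinearMap.mem_ker, hd z] at hz'
    have h1 : z 1 = 0 := by simpa [x0, y2, y4] using congrFun hz' 0
    have h3 : z 3 = 0 := by simpa [x0, y2, y4, h1] using congrFun hz' 2
    refine ⟨U * (U * z 0 - z 2) + z 4, ?_⟩
    rw [LinearMap.toSpanSingleton_apply, ← Submodule.Quotient.mk_smul,
      Submodule.Quotient.eq]
    refine ⟨-z 0 • x2 + (U * z 0 - z 2) • x4, ?_⟩
    rw [map_add, map_smul, map_smul, hx2, hx4]
    funext i
    fin_cases i <;> simp [x0, y2, y4, h1, h3]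
    · ring
    · ring
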